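/- Let m be a positive integer. On the quotient space Q′ := 𝔈′/𝔐, consider the operators induced by φ(u) := (∂₁u − m·z₁^{−m−1}·u, ∂₂u) and ψ(ω₁, ω₂) := ∂₁ω₂ − m·z₁^{−m−1}·ω₂ − ∂₂ω₁. Then: (i) φ and ψ map 𝔐 (respectively 𝔐 ⊕ 𝔐) into 𝔐 ⊕ 𝔐 (respectively 𝔐), so they descend to maps φ̄ : Q′ → Q′ ⊕ Q′ and ψ̄ : Q′ ⊕ Q′ → Q′ with ψ̄ ∘ φ̄ = 0; (ii) dim ker φ̄ = m; (iii) ker ψ̄ = im φ̄; (iv) ψ̄ is surjective. -/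

import Mathlib

/-- `A′ = {z ∈ ℂ² : z₁ ≠ 0}`. -/
def A'set : Set (ℂ × ℂ) := {z | z.1 ≠ 0}

/-- Representatives of germs in `𝔈′`: total functions that are holomorphic on
`V ∩ A′` for some open neighbourhood `V` of the origin. -/
def E'sp : Set (ℂ × ℂ → ℂ) :=
  {f | ∃ V : Set (ℂ × ℂ), IsOpen V ∧ ((0 : ℂ), (0 : ℂ)) ∈ V ∧
    DifferentiableOn ℂ f (V ∩ A'set)}

/-- Representatives of germs in `𝔐` (meromorphic germs along `{z₁ = 0}`):
for some `N`, `z₁^N·f` extends holomorphically to `V`. -/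
def Mset : Set (ℂ × ℂ → ℂ) :=
  {f | ∃ V : Set (ℂ × ℂ), IsOpen V ∧ ((0 : ℂ), (0 : ℂ)) ∈ V ∧
    ∃ (N : ℕ) (g : ℂ × ℂ → ℂ),
      DifferentiableOn ℂ g V ∧ ∀ z ∈ V ∩ A'set, g z = z.1 ^ N * f z}

/-- First complex partial derivative. -/
noncomputable def pd1 (f : ℂ × ℂ → ℂ) : ℂ × ℂ → ℂ :=
  fun x => deriv (fun w => f (w, x.2)) x.1

/-- Second complex partial derivative. -/
noncomputable def pd2 (f : ℂ × ℂ → ℂ) : ℂ × ℂ → ℂ :=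
  fun x => deriv (fun w => f (x.1, w)) x.2

/-- First component of `φ(u) = (∂₁u − m·z₁^{−m−1}u, ∂₂u)`. -/
noncomputable def φ1 (m : ℕ) (u : ℂ × ℂ → ℂ) : ℂ × ℂ → ℂ :=
  fun x => pd1 u x - (m : ℂ) * x.1 ^ (-(m : ℤ) - 1) * u x

/-- Second component of `φ`. -/
noncomputable def φ2 (u : ℂ × ℂ → ℂ) : ℂ × ℂ → ℂ :=
  fun x => pd2 u x

/-- `ψ(ω₁,ω₂) = ∂₁ω₂ − m·z₁^{−m−1}·ω₂ − ∂₂ω₁`. -/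
noncomputable def ψop (m : ℕ) (ω₁ ω₂ : ℂ × ℂ → ℂ) : ℂ × ℂ → ℂ :=
  fun x => pd1 ω₂ x - (m : ℂ) * x.1 ^ (-(m : ℤ) - 1) * ω₂ x - pd2 ω₁ x


open Set Metric Filter Topology MeasureTheory

section ParametricIntegral

theorem ContinuousOn.aestronglyMeasurable_uIoc {F : Type*} [NormedAddCommGroup F] {g : ℝ → F}
    {a b : ℝ} (hg : ContinuousOn g (Icc a b)) (hab : a ≤ b) :
    AEStronglyMeasurable g (volume.restrict (uIoc a b)) :=
  (hg.aestronglyMeasurable_of_isCompact isCompact_Icc measurableSet_Icc).mono_measure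
    (Measure.restrict_mono (by rw [uIoc_of_le hab]; exact Ioc_subset_Icc_self) le_rfl)

variable {E : Type*} [NormedAddCommGroup E] [NormedSpace ℂ E]

/-- Cauchy's estimate for the Fréchet derivative. -/
theorem norm_fderiv_le_of_norm_le_on_ball {f : E → ℂ} {x : E} {ρ C : ℝ} (hρ : 0 < ρ)
    (hf : DifferentiableOn ℂ f (ball x ρ)) (hC : ∀ y ∈ ball x ρ, ‖f y‖ ≤ C) :
    ‖fderiv ℂ f x‖ ≤ (C + C) / ρ := by
  refine Complex.norm_fderiv_le_div_of_mapsTo_ball hf (fun y hy => ?_) hρ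
  rw [mem_closedBall, dist_eq_norm]
  exact (norm_sub_le _ _).trans (add_le_add (hC y hy) (hC x (mem_ball_self hρ)))

/-- A parametric integral of a jointly continuous family of holomorphic functions is
holomorphic. -/
theorem differentiableOn_intervalIntegral_of_continuousOn [ProperSpace E]
    {G : E → ℝ → ℂ} {U : Set E} {a b : ℝ} (hU : IsOpen U) (hab : a ≤ b)
    (hc : ContinuousOn (fun p : E × ℝ => G p.1 p.2) (U ×ˢ Icc a b))
    (hd : ∀ t ∈ Icc a b, DifferentiableOn ℂ (fun x => G x t) U) :
    DifferentiableOn ℂ (fun x => ∫ t in a..b, G x t) U := by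
  intro x₀ hx₀
  obtain ⟨δ, hδ, hδU⟩ := nhds_basis_closedBall.mem_iff.1 (hU.mem_nhds hx₀)
  have hsub : ∀ x ∈ ball x₀ (δ / 2), ball x (δ / 2) ⊆ closedBall x₀ δ := fun x hx =>
    (ball_subset_ball' (by rw [mem_ball] at hx; linarith)).trans ball_subset_closedBall
  have hK : IsCompact (closedBall x₀ δ ×ˢ Icc a b) :=
    (isCompact_closedBall x₀ δ).prod isCompact_Icc
  have hcK : ContinuousOn (fun p : E × ℝ => G p.1 p.2) (closedBall x₀ δ ×ˢ Icc a b) :=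
    hc.mono (prod_mono hδU Subset.rfl)
  obtain ⟨C, hC⟩ := hK.exists_bound_of_continuousOn hcK
  have hcont : ∀ x ∈ U, ContinuousOn (G x) (Icc a b) := fun x hx =>
    hc.comp (f := fun t => (x, t)) (by fun_prop) fun t ht => ⟨hx, ht⟩
  have hι : uIoc a b ⊆ Icc a b := by rw [uIoc_of_le hab]; exact Ioc_subset_Icc_self
  have hhalf : 0 < δ / 2 := by positivity
  have hderiv : ContinuousOn (fun t => fderiv ℂ (fun x => G x t) x₀) (Icc a b) := by
    have huc := hK.uniformContinuousOn_of_continuous hcK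
    rw [Metric.uniformContinuousOn_iff_le] at huc
    rw [Metric.continuousOn_iff]
    intro t ht ε hε
    obtain ⟨η, hη, h⟩ := huc (ε * δ / 8) (by positivity)
    refine ⟨η, hη, fun s hs hst => ?_⟩
    have hxU : U ∈ 𝓝 x₀ := hU.mem_nhds hx₀
    rw [dist_eq_norm, ← fderiv_fun_sub ((hd s hs).differentiableAt hxU)
      ((hd t ht).differentiableAt hxU)]
    have hball : ball x₀ (δ / 2) ⊆ closedBall x₀ δ := hsub x₀ (mem_ball_self hhalf)
    refine (norm_fderiv_le_of_norm_le_on_ball (C := ε * δ / 8) hhalf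
      (((hd s hs).sub (hd t ht)).mono (hball.trans hδU)) fun y hy => ?_).trans_lt ?_
    · change ‖G y s - G y t‖ ≤ _
      rw [← dist_eq_norm]
      refine h (y, s) ⟨hball hy, hs⟩ (y, t) ⟨hball hy, ht⟩ ?_
      simpa [Prod.dist_eq, hη.le] using hst.le
    · field_simp
      linarith
  refine (intervalIntegral.hasFDerivAt_integral_of_dominated_of_fderiv_le
    (F' := fun x t => fderiv ℂ (fun x => G x t) x) (bound := fun _ => (C + C) / (δ / 2))
    (ball_mem_nhds x₀ hhalf) ?_ ?_ (hderiv.aestronglyMeasurable_uIoc hab) ?_ intervalIntegrable_const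
    ?_).differentiableAt.differentiableWithinAt
  · filter_upwards [hU.mem_nhds hx₀] with x hx using (hcont x hx).aestronglyMeasurable_uIoc hab
  · exact (hcont x₀ hx₀).intervalIntegrable_of_Icc hab
  · refine Eventually.of_forall fun t ht x hx => ?_
    exact norm_fderiv_le_of_norm_le_on_ball hhalf
      ((hd t (hι ht)).mono ((hsub x hx).trans hδU)) fun y hy => hC (y, t) ⟨hsub x hx hy, hι ht⟩
  · refine Eventually.of_forall fun t ht x hx => ?_
    exact ((hd t (hι ht)).differentiableAt
      (hU.mem_nhds (hδU (hsub x hx (mem_ball_self hhalf))))).hasFDerivAt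

end ParametricIntegral

section PartialDerivatives

variable {f g : ℂ × ℂ → ℂ} {U : Set (ℂ × ℂ)} {x : ℂ × ℂ}

theorem hasDerivAt_fst_of_hasFDerivAt {f' : ℂ × ℂ →L[ℂ] ℂ} (h : HasFDerivAt f f' x) :
    HasDerivAt (fun w => f (w, x.2)) (f' (1, 0)) x.1 :=
  HasFDerivAt.comp_hasDerivAt (f := fun w => (w, x.2)) x.1 h
    ((hasDerivAt_id x.1).prodMk (hasDerivAt_const x.1 x.2))

theorem hasDerivAt_snd_of_hasFDerivAt {f' : ℂ × ℂ →L[ℂ] ℂ} (h : HasFDerivAt f f' x) :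
    HasDerivAt (fun w => f (x.1, w)) (f' (0, 1)) x.2 :=
  HasFDerivAt.comp_hasDerivAt (f := fun w => (x.1, w)) x.2 h
    ((hasDerivAt_const x.2 x.1).prodMk (hasDerivAt_id x.2))

theorem pd1_eq_fderiv (h : DifferentiableAt ℂ f x) : pd1 f x = fderiv ℂ f x (1, 0) :=
  (hasDerivAt_fst_of_hasFDerivAt h.hasFDerivAt).deriv

theorem pd2_eq_fderiv (h : DifferentiableAt ℂ f x) : pd2 f x = fderiv ℂ f x (0, 1) :=
  (hasDerivAt_snd_of_hasFDerivAt h.hasFDerivAt).deriv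

theorem DifferentiableAt.hasDerivAt_pd1 (h : DifferentiableAt ℂ f x) :
    HasDerivAt (fun w => f (w, x.2)) (pd1 f x) x.1 :=
  (hasDerivAt_fst_of_hasFDerivAt h.hasFDerivAt).differentiableAt.hasDerivAt

theorem DifferentiableAt.hasDerivAt_pd2 (h : DifferentiableAt ℂ f x) :
    HasDerivAt (fun w => f (x.1, w)) (pd2 f x) x.2 :=
  (hasDerivAt_snd_of_hasFDerivAt h.hasFDerivAt).differentiableAt.hasDerivAt

theorem Filter.EventuallyEq.pd1_eq (h : f =ᶠ[𝓝 x] g) : pd1 f x = pd1 g x :=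
  EventuallyEq.deriv_eq <| (show ContinuousAt (fun w : ℂ => (w, x.2)) x.1 by fun_prop).eventually h

theorem Filter.EventuallyEq.pd2_eq (h : f =ᶠ[𝓝 x] g) : pd2 f x = pd2 g x :=
  EventuallyEq.deriv_eq <| (show ContinuousAt (fun w : ℂ => (x.1, w)) x.2 by fun_prop).eventually h

theorem differentiableOn_pd1 (hU : IsOpen U) (hf : DifferentiableOn ℂ f U) :
    DifferentiableOn ℂ (pd1 f) U := by
  intro x₀ hx₀
  obtain ⟨ρ, hρ, hρU⟩ := nhds_basis_closedBall.mem_iff.1 (hU.mem_nhds hx₀)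
  have hmem : ∀ w ∈ closedBall x₀.1 ρ, ∀ x ∈ ball x₀ ρ, (w, x.2) ∈ U := fun w hw x hx =>
    hρU (by
      rw [← ball_prod_same] at hx
      rw [← closedBall_prod_same]
      exact ⟨hw, ball_subset_closedBall hx.2⟩)
  have hne : ∀ θ : ℝ, ∀ x ∈ ball x₀ ρ, circleMap x₀.1 ρ θ - x.1 ≠ 0 := fun θ x hx => by
    rw [← ball_prod_same] at hx
    exact sub_ne_zero.2 (sphere_disjoint_ball.ne_of_mem
      (circleMap_mem_sphere x₀.1 hρ.le θ) hx.1)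
  have hcirc : ∀ θ : ℝ, circleMap x₀.1 ρ θ ∈ closedBall x₀.1 ρ := fun θ =>
    circleMap_mem_closedBall x₀.1 hρ.le θ
  have key : DifferentiableOn ℂ (fun x : ℂ × ℂ => ∫ θ in (0 : ℝ)..2 * Real.pi,
      deriv (circleMap x₀.1 ρ) θ • (((circleMap x₀.1 ρ θ - x.1) ^ 2)⁻¹ •
        f (circleMap x₀.1 ρ θ, x.2))) (ball x₀ ρ) := by
    refine differentiableOn_intervalIntegral_of_continuousOn isOpen_ball
      Real.two_pi_pos.le ?_ ?_
    · simp only [deriv_circleMap]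
      have hcm : Continuous fun p : (ℂ × ℂ) × ℝ => circleMap x₀.1 ρ p.2 :=
        (continuous_circleMap x₀.1 ρ).comp continuous_snd
      have hcm₀ : Continuous fun p : (ℂ × ℂ) × ℝ => circleMap 0 ρ p.2 :=
        (continuous_circleMap 0 ρ).comp continuous_snd
      have hinv : ContinuousOn (fun p : (ℂ × ℂ) × ℝ => ((circleMap x₀.1 ρ p.2 - p.1.1) ^ 2)⁻¹)
          (ball x₀ ρ ×ˢ Icc 0 (2 * Real.pi)) :=
        ContinuousOn.inv₀ (by fun_prop) fun p hp => pow_ne_zero 2 (hne p.2 p.1 hp.1)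
      refine (hcm₀.mul continuous_const).continuousOn.smul (hinv.smul ?_)
      exact hf.continuousOn.comp (f := fun p : (ℂ × ℂ) × ℝ => (circleMap x₀.1 ρ p.2, p.1.2))
        (by fun_prop) fun p hp => hmem _ (hcirc p.2) p.1 hp.1
    · intro θ _
      have hinv : DifferentiableOn ℂ (fun x : ℂ × ℂ => ((circleMap x₀.1 ρ θ - x.1) ^ 2)⁻¹)
          (ball x₀ ρ) :=
        DifferentiableOn.inv (by fun_prop) fun x hx => pow_ne_zero 2 (hne θ x hx)
      have hfc : DifferentiableOn ℂ (fun x : ℂ × ℂ => f (circleMap x₀.1 ρ θ, x.2)) (ball x₀ ρ) :=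
        hf.comp (f := fun x : ℂ × ℂ => (circleMap x₀.1 ρ θ, x.2))
          (by fun_prop) fun x hx => hmem _ (hcirc θ) x hx
      exact (hinv.smul hfc).const_smul (deriv (circleMap x₀.1 ρ) θ)
  refine (((key.const_smul (2 * Real.pi * Complex.I : ℂ)⁻¹).differentiableAt
    (ball_mem_nhds x₀ hρ)).congr_of_eventuallyEq ?_).differentiableWithinAt
  filter_upwards [ball_mem_nhds x₀ hρ] with x hx
  have hx' := hx
  rw [← ball_prod_same] at hx'
  exact (Complex.two_pi_I_inv_smul_circleIntegral_sub_sq_inv_smul_of_differentiable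
    (U := (fun w => (w, x.2)) ⁻¹' U) (hU.preimage (by fun_prop)) (fun w hw => hmem w hw x hx)
    (hf.comp (f := fun w => (w, x.2)) (by fun_prop) fun w hw => hw) hx'.1).symm

theorem differentiableOn_pd2 (hU : IsOpen U) (hf : DifferentiableOn ℂ f U) :
    DifferentiableOn ℂ (pd2 f) U := by
  have hU' : IsOpen (Prod.swap ⁻¹' U) := hU.preimage continuous_swap
  have h : DifferentiableOn ℂ (fun x : ℂ × ℂ => f (x.2, x.1)) (Prod.swap ⁻¹' U) :=
    hf.comp (f := fun x : ℂ × ℂ => (x.2, x.1)) (by fun_prop) fun x hx => hx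
  exact (differentiableOn_pd1 hU' h).comp (f := fun x : ℂ × ℂ => (x.2, x.1)) (by fun_prop) fun x hx => hx

theorem pd1_pd2_comm (hU : IsOpen U) (hf : DifferentiableOn ℂ f U) (hx : x ∈ U) :
    pd1 (pd2 f) x = pd2 (pd1 f) x := by
  have hat : ∀ y ∈ U, DifferentiableAt ℂ f y := fun y hy => hf.differentiableAt (hU.mem_nhds hy)
  have h1 := (differentiableOn_pd1 hU hf).differentiableAt (hU.mem_nhds hx)
  have h2 := (differentiableOn_pd2 hU hf).differentiableAt (hU.mem_nhds hx)
  have hev : ∀ᶠ y in 𝓝 x, y ∈ U := hU.mem_nhds hx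
  have hdiff : DifferentiableAt ℂ (fderiv ℂ f) x := by
    refine DifferentiableAt.congr_of_eventuallyEq (f := fun y =>
      pd1 f y • ContinuousLinearMap.fst ℂ ℂ ℂ + pd2 f y • ContinuousLinearMap.snd ℂ ℂ ℂ)
      ((h1.smul_const _).add (h2.smul_const _)) ?_
    filter_upwards [hev] with y hy
    rw [pd1_eq_fderiv (hat y hy), pd2_eq_fderiv (hat y hy)]
    ext <;> simp
  have hsymm := second_derivative_symmetric_of_eventually (𝕜 := ℂ)
    (hev.mono fun y hy => (hat y hy).hasFDerivAt) hdiff.hasFDerivAt (1, 0) (0, 1)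
  have happ : ∀ v : ℂ × ℂ, HasFDerivAt (fun y => fderiv ℂ f y v)
      ((fderiv ℂ (fderiv ℂ f) x).flip v) x := fun v =>
    ((ContinuousLinearMap.apply ℂ ℂ v).hasFDerivAt.comp x hdiff.hasFDerivAt)
  have e2 : pd2 f =ᶠ[𝓝 x] fun y => fderiv ℂ f y (0, 1) :=
    hev.mono fun y hy => pd2_eq_fderiv (hat y hy)
  have e1 : pd1 f =ᶠ[𝓝 x] fun y => fderiv ℂ f y (1, 0) :=
    hev.mono fun y hy => pd1_eq_fderiv (hat y hy)
  rw [e2.pd1_eq, e1.pd2_eq, pd1_eq_fderiv (happ _).differentiableAt,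
    pd2_eq_fderiv (happ _).differentiableAt, (happ _).fderiv, (happ _).fderiv]
  exact hsymm

end PartialDerivatives

section Primitives

theorem exists_pd2_primitive {f : ℂ × ℂ → ℂ} {S : Set ℂ} {r : ℝ} (hS : IsOpen S)
    (hf : DifferentiableOn ℂ f (S ×ˢ ball 0 r)) :
    ∃ F : ℂ × ℂ → ℂ, DifferentiableOn ℂ F (S ×ˢ ball 0 r) ∧
      ∀ z ∈ S ×ˢ ball (0 : ℂ) r, pd2 F z = f z := by
  have hscale : ∀ w ∈ ball (0 : ℂ) r, ∀ t ∈ Icc (0 : ℝ) 1, (t : ℂ) * w ∈ ball (0 : ℂ) r := by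
    intro w hw t ht
    rw [mem_ball_zero_iff] at hw ⊢
    rw [norm_mul, Complex.norm_real, Real.norm_of_nonneg ht.1]
    exact (mul_le_of_le_one_left (norm_nonneg w) ht.2).trans_lt hw
  refine ⟨fun z => ∫ t in (0 : ℝ)..1, z.2 * f (z.1, t * z.2), ?_, ?_⟩
  · refine differentiableOn_intervalIntegral_of_continuousOn (hS.prod isOpen_ball) zero_le_one ?_ ?_
    · refine ContinuousOn.mul (by fun_prop) ?_
      exact hf.continuousOn.comp (f := fun p : (ℂ × ℂ) × ℝ => (p.1.1, (p.2 : ℂ) * p.1.2))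
        (by fun_prop) fun p hp => ⟨hp.1.1, hscale _ hp.1.2 _ hp.2⟩
    · intro t ht
      refine DifferentiableOn.mul (by fun_prop) ?_
      exact hf.comp (f := fun z : ℂ × ℂ => (z.1, (t : ℂ) * z.2)) (by fun_prop)
        fun z hz => ⟨hz.1, hscale _ hz.2 _ ht⟩
  · rintro ⟨a, b⟩ ⟨ha, hb⟩
    have hslice : DifferentiableOn ℂ (fun w => f (a, w)) (ball 0 r) :=
      hf.comp (f := fun w => (a, w)) (by fun_prop) fun w hw => ⟨ha, hw⟩
    obtain ⟨G, hG⟩ := hslice.isExactOn_ball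
    have hint : ∀ w ∈ ball (0 : ℂ) r, ∫ t in (0 : ℝ)..1, w * f (a, t * w) = G w - G 0 := by
      intro w hw
      have h := intervalIntegral.integral_eq_sub_of_hasDerivAt
        (f := fun t : ℝ => G (t * w)) (f' := fun t : ℝ => w * f (a, t * w)) (a := 0) (b := 1)
        (fun t ht => ?_) ?_
      · simpa using h
      · rw [uIcc_of_le zero_le_one] at ht
        have h1 : HasDerivAt (fun s : ℂ => G (s * w)) (f (a, t * w) * (1 * w)) (t : ℂ) :=
          (hG _ (hscale w hw t ht)).comp (t : ℂ) ((hasDerivAt_id (t : ℂ)).mul_const w)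
        simpa [mul_comm] using h1.comp_ofReal
      · refine ContinuousOn.intervalIntegrable_of_Icc zero_le_one ?_
        refine ContinuousOn.mul (by fun_prop) ?_
        exact hslice.continuousOn.comp (f := fun t : ℝ => (t : ℂ) * w) (by fun_prop)
          fun t ht => hscale w hw t ht
    refine HasDerivAt.deriv (((hG b hb).sub_const (G 0)).congr_of_eventuallyEq ?_)
    filter_upwards [isOpen_ball.mem_nhds hb] with w hw using hint w hw

end Primitives

section Splitting

theorem circleIntegral_cauchy_eq_of_le {f : ℂ → ℂ} {T ρ ρ' : ℝ} {w : ℂ}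
    (hf : DifferentiableOn ℂ f (closedBall 0 T)ᶜ) (hT : 0 ≤ T) (hTρ : T < ρ) (hρ : ρ ≤ ρ')
    (hw : w ∈ ball (0 : ℂ) ρ) :
    (∮ s in C(0, ρ'), (s - w)⁻¹ • f s) = ∮ s in C(0, ρ), (s - w)⁻¹ • f s := by
  have hinv : DifferentiableOn ℂ (fun s => (s - w)⁻¹) ((closedBall 0 T)ᶜ ∩ {w}ᶜ) :=
    DifferentiableOn.inv (by fun_prop) fun s hs => sub_ne_zero.2 hs.2
  have hd : DifferentiableOn ℂ (fun s => (s - w)⁻¹ • f s) ((closedBall 0 T)ᶜ ∩ {w}ᶜ) :=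
    hinv.smul (hf.mono inter_subset_left)
  have hopen : IsOpen ((closedBall (0 : ℂ) T)ᶜ ∩ {w}ᶜ) :=
    isClosed_closedBall.isOpen_compl.inter isOpen_compl_singleton
  have hmem : ∀ s ∉ ball (0 : ℂ) ρ, s ∈ (closedBall (0 : ℂ) T)ᶜ ∩ {w}ᶜ := fun s hs =>
    ⟨fun h => hs (closedBall_subset_ball hTρ h), fun h => hs (by rw [h]; exact hw)⟩
  refine Complex.circleIntegral_eq_of_differentiable_on_annulus_off_countable (s := ∅)
    (hT.trans_lt hTρ) hρ countable_empty (hd.continuousOn.mono fun s hs => hmem s hs.2) ?_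
  rintro s ⟨⟨-, hs⟩, -⟩
  exact hd.differentiableAt (hopen.mem_nhds (hmem s fun h => hs (ball_subset_closedBall h)))

theorem circleIntegral_cauchy_sub_of_mem_annulus {f : ℂ → ℂ} {T ρ ρ' : ℝ} {w : ℂ}
    (hf : DifferentiableOn ℂ f (closedBall 0 T)ᶜ) (hT : 0 ≤ T) (hTρ : T < ρ)
    (hw : ρ < ‖w‖) (hw' : ‖w‖ < ρ') :
    (∮ s in C(0, ρ'), (s - w)⁻¹ • f s) - 2 * Real.pi * Complex.I * f w =
      ∮ s in C(0, ρ), (s - w)⁻¹ • f s := by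
  have hopen : IsOpen (closedBall (0 : ℂ) T)ᶜ := isClosed_closedBall.isOpen_compl
  have hρ0 : 0 < ρ := hT.trans_lt hTρ
  have hwT : w ∈ (closedBall (0 : ℂ) T)ᶜ := by
    simp only [mem_compl_iff, mem_closedBall_zero_iff, not_le]; linarith
  have hd : DifferentiableOn ℂ (dslope f w) (closedBall 0 T)ᶜ :=
    (Complex.differentiableOn_dslope (hopen.mem_nhds hwT)).2 hf
  have hmem : ∀ s ∉ ball (0 : ℂ) ρ, s ∈ (closedBall (0 : ℂ) T)ᶜ := fun s hs h =>
    hs (closedBall_subset_ball hTρ h)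
  have hann : (∮ s in C(0, ρ'), dslope f w s) = ∮ s in C(0, ρ), dslope f w s := by
    refine Complex.circleIntegral_eq_of_differentiable_on_annulus_off_countable (s := ∅)
      hρ0 (hw.trans hw').le countable_empty (hd.continuousOn.mono fun s hs => hmem s hs.2) ?_
    rintro s ⟨⟨-, hs⟩, -⟩
    exact hd.differentiableAt (hopen.mem_nhds (hmem s fun h => hs (ball_subset_closedBall h)))
  have hexp : ∀ R : ℝ, ρ ≤ R → R ≠ ‖w‖ → (∮ s in C(0, R), dslope f w s) =
      (∮ s in C(0, R), (s - w)⁻¹ • f s) - (∮ s in C(0, R), (s - w)⁻¹) * f w := by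
    intro R hR hRw
    have hR0 : 0 ≤ R := hρ0.le.trans hR
    have hne : ∀ s ∈ sphere (0 : ℂ) R, s ≠ w := by
      rintro s hs rfl
      exact hRw (by simpa using hs.symm)
    have hinv : ContinuousOn (fun s => (s - w)⁻¹) (sphere 0 R) :=
      ContinuousOn.inv₀ (by fun_prop) fun s hs => sub_ne_zero.2 (hne s hs)
    have hfc : ContinuousOn f (sphere 0 R) := hf.continuousOn.mono fun s hs => by
      rw [mem_sphere_zero_iff_norm] at hs
      simp only [mem_compl_iff, mem_closedBall_zero_iff, not_le]; linarith
    have hmul : (∮ s in C(0, R), (s - w)⁻¹) * f w = ∮ s in C(0, R), (s - w)⁻¹ • f w := by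
      simpa using (circleIntegral.integral_smul_const (fun s => (s - w)⁻¹) (f w) 0 R).symm
    have hint₁ : CircleIntegrable (fun s => (s - w)⁻¹ • f s) 0 R :=
      (hinv.smul hfc).circleIntegrable hR0
    have hint₂ : CircleIntegrable (fun s => (s - w)⁻¹ • f w) 0 R :=
      (hinv.smul continuousOn_const).circleIntegrable hR0
    rw [hmul, ← circleIntegral.integral_sub hint₁ hint₂]
    refine circleIntegral.integral_congr hR0 fun s hs => ?_
    simp only [dslope_of_ne f (hne s hs), slope_def_module, smul_sub]
  have hzero : (∮ s in C(0, ρ), (s - w)⁻¹) = 0 := by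
    refine Complex.circleIntegral_eq_zero_of_differentiable_on_off_countable hρ0.le
      countable_empty ?_ ?_
    · refine ContinuousOn.inv₀ (by fun_prop) fun s hs => sub_ne_zero.2 ?_
      rintro rfl
      rw [mem_closedBall_zero_iff] at hs; linarith
    · rintro s ⟨hs, -⟩
      refine DifferentiableAt.inv (by fun_prop) (sub_ne_zero.2 ?_)
      rintro rfl
      rw [mem_ball_zero_iff] at hs; linarith
  rw [hexp ρ' (hw.trans hw').le hw'.ne', hexp ρ le_rfl hw.ne, hzero,
    circleIntegral.integral_sub_inv_of_mem_ball (by simpa using hw'), zero_mul, sub_zero] at hann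
  exact hann

theorem exists_entire_add_of_differentiableOn_punctured {f : ℂ → ℂ} {r : ℝ} (hr : 0 < r)
    (hf : DifferentiableOn ℂ f (ball 0 r \ {0})) :
    ∃ (U h : ℂ → ℂ) (δ : ℝ), Differentiable ℂ U ∧ 0 < δ ∧ δ ≤ r ∧
      DifferentiableOn ℂ h (ball 0 δ) ∧ ∀ z ∈ ball (0 : ℂ) δ \ {0}, f z = U z⁻¹ + h z := by
  set T := r⁻¹ with hTdef
  have hT : 0 < T := inv_pos.2 hr
  set g : ℂ → ℂ := fun s => f s⁻¹ with hg
  have hgd : DifferentiableOn ℂ g (closedBall 0 T)ᶜ := by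
    have hne : ∀ s ∈ (closedBall (0 : ℂ) T)ᶜ, T < ‖s‖ := fun s hs => by simpa using hs
    refine hf.comp (f := fun s : ℂ => s⁻¹) (DifferentiableOn.inv differentiableOn_id fun s hs => ?_)
      fun s hs => ⟨?_, ?_⟩
    · exact norm_pos_iff.1 (hT.trans (hne s hs))
    · rw [mem_ball_zero_iff, norm_inv]
      exact inv_lt_of_inv_lt₀ hr (hne s hs)
    · exact inv_ne_zero (norm_pos_iff.1 (hT.trans (hne s hs)))
  have hgc : ∀ ρ, T < ρ → ContinuousOn g (sphere 0 ρ) := fun ρ hρ =>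
    hgd.continuousOn.mono fun s hs => by
      rw [mem_sphere_zero_iff_norm] at hs
      simp only [mem_compl_iff, mem_closedBall_zero_iff, not_le]; linarith
  set c : ℝ → ℂ → ℂ := fun ρ w =>
    (2 * Real.pi * Complex.I : ℂ)⁻¹ • ∮ s in C(0, ρ), (s - w)⁻¹ • g s with hc
  have hcd : ∀ ρ, T < ρ → ∀ w ∈ ball (0 : ℂ) ρ, DifferentiableAt ℂ (c ρ) w := by
    intro ρ hρ w hw
    have hρ0 : 0 < ρ := hT.trans hρ
    lift ρ to NNReal using hρ0.le
    have hps := hasFPowerSeriesOn_cauchy_integral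
      ((hgc ρ hρ).circleIntegrable hρ0.le) (by exact_mod_cast hρ0)
    refine (hps.differentiableOn).differentiableAt (Metric.isOpen_eball.mem_nhds ?_)
    simpa [Metric.eball_coe] using hw
  have hcc : ∀ ρ ρ', T < ρ → ρ ≤ ρ' → ∀ w ∈ ball (0 : ℂ) ρ, c ρ' w = c ρ w :=
    fun ρ ρ' h1 h2 w hw => by
      simp only [hc, circleIntegral_cauchy_eq_of_le hgd hT.le h1 h2 hw]
  set U : ℂ → ℂ := fun w => c (‖w‖ + T + 1) w with hU
  have hUd : Differentiable ℂ U := by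
    intro w₀
    refine (hcd (‖w₀‖ + T + 2) (by linarith [norm_nonneg w₀]) w₀
      (by rw [mem_ball_zero_iff]; linarith)).congr_of_eventuallyEq ?_
    filter_upwards [ball_mem_nhds w₀ one_pos] with w hw
    have h1 : ‖w‖ ≤ ‖w₀‖ + 1 := by
      have := norm_sub_norm_le w w₀
      rw [mem_ball, dist_eq_norm] at hw
      linarith
    exact (hcc _ _ (by linarith [norm_nonneg w]) (by linarith) w
      (by rw [mem_ball_zero_iff]; linarith)).symm
  obtain ⟨C, hC⟩ := (isCompact_sphere (0 : ℂ) (T + 1)).exists_bound_of_continuousOn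
    (hgc (T + 1) (by linarith))
  have hbound : ∀ w : ℂ, T + 2 < ‖w‖ → ‖U w - g w‖ ≤ (T + 1) * C := by
    intro w hw
    have hsub := circleIntegral_cauchy_sub_of_mem_annulus (ρ := T + 1) (ρ' := ‖w‖ + T + 1)
      (w := w) hgd hT.le (by linarith) (by linarith) (by linarith)
    have h2 : U w - g w =
        (2 * Real.pi * Complex.I : ℂ)⁻¹ • ∮ s in C(0, T + 1), (s - w)⁻¹ • g s := by
      rw [← hsub, smul_sub]
      simp only [hU, hc, smul_eq_mul]
      rw [inv_mul_cancel_left₀ Complex.two_pi_I_ne_zero]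
    rw [h2]
    refine circleIntegral.norm_two_pi_i_inv_smul_integral_le_of_norm_le_const
      (by linarith) fun s hs => ?_
    rw [norm_smul, norm_inv]
    have h3 : 1 ≤ ‖s - w‖ := by
      have := norm_sub_norm_le w s
      rw [norm_sub_rev, mem_sphere_zero_iff_norm.1 hs] at this
      linarith
    exact (mul_le_of_le_one_left (norm_nonneg _) (inv_le_one_of_one_le₀ h3)).trans (hC s hs)
  set δ := (T + 2)⁻¹ with hδ
  have hδ0 : 0 < δ := by positivity
  have hδr : δ ≤ r := by
    rw [hδ, inv_le_comm₀ (by positivity) hr]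
    linarith
  have hdiff : DifferentiableOn ℂ (fun z => f z - U z⁻¹) (ball 0 δ \ {0}) := by
    refine (hf.mono (sdiff_subset_sdiff_left (ball_subset_ball hδr))).sub ?_
    exact hUd.comp_differentiableOn (DifferentiableOn.inv differentiableOn_id fun z hz => hz.2)
  refine ⟨U, _, δ, hUd, hδ0, hδr, Complex.differentiableOn_update_limUnder_of_bddAbove
    (ball_mem_nhds 0 hδ0) hdiff ⟨(T + 1) * C, ?_⟩, fun z hz => ?_⟩
  · rintro _ ⟨z, ⟨hz, hz0⟩, rfl⟩
    have h1 : T + 2 < ‖z⁻¹‖ := by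
      rw [mem_ball_zero_iff] at hz
      rw [norm_inv]
      exact lt_inv_of_lt_inv₀ (norm_pos_iff.2 hz0) hz
    have h2 := hbound z⁻¹ h1
    rw [norm_sub_rev] at h2
    simpa [hg] using h2
  · rw [Function.update_of_ne hz.2]
    ring

end Splitting

section ModelEquation

/-- `W` solves the model equation `W′ + m·w^{m−1}·W = R` on `ℂ`; this is the operator
`∂₁ − m·z₁^{−m−1}` written in the coordinate `w = z₁⁻¹`, up to the factor `−w²`. -/
def IsModelSolution (m : ℕ) (R W : ℂ → ℂ) : Prop :=
  ∀ w, HasDerivAt W (R w - m * w ^ (m - 1) * W w) w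

variable {m : ℕ} {R R₁ R₂ W W₁ W₂ : ℂ → ℂ}

theorem IsModelSolution.differentiable (h : IsModelSolution m R W) : Differentiable ℂ W :=
  fun w => (h w).differentiableAt

theorem IsModelSolution.add (h₁ : IsModelSolution m R₁ W₁) (h₂ : IsModelSolution m R₂ W₂) :
    IsModelSolution m (fun w => R₁ w + R₂ w) (fun w => W₁ w + W₂ w) := fun w => by
  refine HasDerivAt.congr_deriv ((h₁ w).add (h₂ w)) ?_
  ring

theorem IsModelSolution.const_mul (c : ℂ) (h : IsModelSolution m R W) :
    IsModelSolution m (fun w => c * R w) (fun w => c * W w) := fun w => by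
  refine HasDerivAt.congr_deriv ((h w).const_mul c) ?_
  ring

theorem IsModelSolution.sum {ι : Type*} (s : Finset ι) {R W : ι → ℂ → ℂ}
    (h : ∀ i ∈ s, IsModelSolution m (R i) (W i)) :
    IsModelSolution m (fun w => ∑ i ∈ s, R i w) (fun w => ∑ i ∈ s, W i w) := fun w => by
  refine HasDerivAt.congr_deriv (HasDerivAt.fun_sum fun i hi => h i hi w) ?_
  rw [Finset.sum_sub_distrib, Finset.mul_sum]

theorem isModelSolution_exp (m : ℕ) :
    IsModelSolution m (fun _ => 0) (fun w => Complex.exp (-w ^ m)) := fun w => by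
  refine HasDerivAt.congr_deriv ((hasDerivAt_pow m w).fun_neg.cexp) ?_
  ring

theorem isModelSolution_one (m : ℕ) :
    IsModelSolution m (fun w => m * w ^ (m - 1)) (fun _ => 1) := fun w => by
  refine HasDerivAt.congr_deriv (hasDerivAt_const w (1 : ℂ)) ?_
  ring

theorem IsModelSolution.unique (h₁ : IsModelSolution m R W₁) (h₂ : IsModelSolution m R W₂)
    (h0 : W₁ 0 = W₂ 0) : W₁ = W₂ := by
  have hd : ∀ w, HasDerivAt (fun w => (W₁ w - W₂ w) * Complex.exp (w ^ m)) 0 w := fun w => by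
    refine HasDerivAt.congr_deriv (((h₁ w).sub (h₂ w)).mul (hasDerivAt_pow m w).cexp) ?_
    simp only [Pi.sub_apply]
    ring
  funext w
  have h := is_const_of_deriv_eq_zero (fun w => (hd w).differentiableAt)
    (fun w => (hd w).deriv) w 0
  rw [h0, sub_self, zero_mul] at h
  exact sub_eq_zero.1 ((mul_eq_zero.1 h).resolve_right (Complex.exp_ne_zero _))

theorem exists_isModelSolution (m : ℕ) (hR : Differentiable ℂ R) :
    ∃ W, IsModelSolution m R W ∧ W 0 = 0 := by
  have hd : Differentiable ℂ fun w => R w * Complex.exp (w ^ m) := by fun_prop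
  obtain ⟨G, hG0, hG⟩ := hd.isExactOn_univ.with_val_at 0 0
  refine ⟨fun w => G w * Complex.exp (-w ^ m), fun w => ?_, by simp [hG0]⟩
  refine HasDerivAt.congr_deriv ((hG w (mem_univ w)).mul (hasDerivAt_pow m w).fun_neg.cexp) ?_
  have h : Complex.exp (w ^ m) * Complex.exp (-w ^ m) = 1 := by
    rw [← Complex.exp_add, add_neg_cancel, Complex.exp_zero]
  linear_combination R w * h

theorem mem_span_sup_range_eval (hm : 0 < m) {W : ℕ → ℂ → ℂ}
    (hW : ∀ k, IsModelSolution m (fun w => w ^ k) (W k)) (hW0 : ∀ k, W k 0 = 0)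
    {p : Polynomial ℂ} {U : ℂ → ℂ} (hU : IsModelSolution m (fun w => p.eval w) U) :
    ∃ (c : Fin m → ℂ) (q : Polynomial ℂ), ∀ w, U w = ∑ i, c i * W i w + q.eval w := by
  have hm0 : (m : ℂ) ≠ 0 := Nat.cast_ne_zero.2 hm.ne'
  let Λ : Polynomial ℂ →ₗ[ℂ] ℂ → ℂ := LinearMap.pi fun w => Polynomial.leval w
  let N : Submodule ℂ (ℂ → ℂ) := Submodule.span ℂ (range fun i : Fin m => W i) ⊔ LinearMap.range Λ
  have hpoly : ∀ q : Polynomial ℂ, (fun w => q.eval w) ∈ N := fun q =>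
    Submodule.mem_sup_right ⟨q, rfl⟩
  have hWN : ∀ k, W k ∈ N := by
    intro k
    induction k using Nat.strong_induction_on with
    | _ k ih =>
      rcases lt_or_ge k m with hk | hk
      · exact Submodule.mem_sup_left (Submodule.subset_span ⟨⟨k, hk⟩, rfl⟩)
      · obtain ⟨j, rfl⟩ := Nat.exists_eq_add_of_le hk
        have hsol : IsModelSolution m (fun w => w ^ (m + j))
            (fun w => (m : ℂ)⁻¹ * w ^ (j + 1) + -((j + 1 : ℂ) * (m : ℂ)⁻¹) * W j w) := by
          intro w
          refine HasDerivAt.congr_deriv (((hasDerivAt_pow (j + 1) w).const_mul (m : ℂ)⁻¹).add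
            ((hW j w).const_mul (-((j + 1 : ℂ) * (m : ℂ)⁻¹)))) ?_
          have h1 : w ^ (m + j) = w ^ (m - 1) * w ^ (j + 1) := by
            rw [← pow_add]; congr 1; omega
          beta_reduce
          rw [h1]
          push_cast
          field_simp
          ring
        rw [(hW (m + j)).unique hsol (by simp [hW0])]
        refine N.add_mem ?_ (N.smul_mem (-((j + 1 : ℂ) * (m : ℂ)⁻¹)) (ih j (by omega)))
        convert hpoly (Polynomial.C (m : ℂ)⁻¹ * Polynomial.X ^ (j + 1)) using 2
        simp
  have hexp : (fun w : ℂ => Complex.exp (-w ^ m)) ∈ N := by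
    have hsol := (isModelSolution_one m).add ((hW (m - 1)).const_mul (-(m : ℂ)))
    have hzero : (fun w : ℂ => (m : ℂ) * w ^ (m - 1) + -(m : ℂ) * w ^ (m - 1)) = fun _ => 0 := by
      funext w; ring
    rw [hzero] at hsol
    rw [(isModelSolution_exp m).unique hsol (by simp [hW0, hm.ne'])]
    exact N.add_mem (by simpa using hpoly 1) (N.smul_mem _ (hWN _))
  have hUN : U ∈ N := by
    have hsol := (IsModelSolution.sum (Finset.range (p.natDegree + 1))
      fun k _ => (hW k).const_mul (p.coeff k)).add ((isModelSolution_exp m).const_mul (U 0))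
    have hR : (fun w : ℂ => ∑ k ∈ Finset.range (p.natDegree + 1), p.coeff k * w ^ k + U 0 * 0) =
        fun w => p.eval w := by
      funext w
      rw [Polynomial.eval_eq_sum_range, mul_zero, add_zero]
    rw [hR] at hsol
    rw [hU.unique hsol (by simp [hW0, hm.ne'])]
    refine N.add_mem ?_ (N.smul_mem _ hexp)
    have hsum := N.sum_mem (t := Finset.range (p.natDegree + 1))
      fun k _ => N.smul_mem (p.coeff k) (hWN k)
    convert hsum using 1
    funext w
    simp
  obtain ⟨y, hy, _, ⟨q, rfl⟩, hyq⟩ := Submodule.mem_sup.1 hUN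
  obtain ⟨c, rfl⟩ := (Submodule.mem_span_range_iff_exists_fun ℂ).1 hy
  refine ⟨c, q, fun w => ?_⟩
  rw [← hyq]
  simp [Λ]

theorem eq_zero_of_sum_eq_eval {W : ℕ → ℂ → ℂ}
    (hW : ∀ k, IsModelSolution m (fun w => w ^ k) (W k)) (hW0 : ∀ k, W k 0 = 0)
    {c : Fin m → ℂ} {q : Polynomial ℂ} (hq : ∀ w, ∑ i, c i * W i w = q.eval w) : c = 0 := by
  rcases Nat.eq_zero_or_pos m with rfl | hm
  · exact Subsingleton.elim _ _
  set p : Polynomial ℂ := ∑ i : Fin m, Polynomial.C (c i) * Polynomial.X ^ (i : ℕ) with hp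
  have hpc : ∀ n, p.coeff n = ∑ i : Fin m, if n = i then c i else 0 := fun n => by
    simp [hp, Polynomial.finsetSum_coeff, Polynomial.coeff_X_pow]
  have hsol := IsModelSolution.sum Finset.univ fun (i : Fin m) _ => (hW i).const_mul (c i)
  have hode : Polynomial.derivative q = p - Polynomial.C (m : ℂ) * Polynomial.X ^ (m - 1) * q := by
    refine Polynomial.funext fun w => ?_
    have h1 := hsol w
    simp only [hq] at h1
    rw [(q.hasDerivAt w).unique h1]
    simp [hp, Polynomial.eval_finsetSum]
  have hdeg : q.natDegree = 0 := by
    by_contra hne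
    have hcoeff := congrArg (fun s => Polynomial.coeff s (q.natDegree + (m - 1))) hode
    have h1 : (Polynomial.derivative q).coeff (q.natDegree + (m - 1)) = 0 :=
      Polynomial.coeff_eq_zero_of_natDegree_lt
        ((Polynomial.natDegree_derivative_lt hne).trans_le (Nat.le_add_right _ _))
    have h2 : p.coeff (q.natDegree + (m - 1)) = 0 := by
      rw [hpc]
      exact Finset.sum_eq_zero fun i _ => if_neg (by omega)
    simp only [Polynomial.coeff_sub, mul_assoc, Polynomial.coeff_C_mul,
      Polynomial.coeff_X_pow_mul, h1, h2, zero_sub, zero_eq_neg, mul_eq_zero,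
      Nat.cast_eq_zero, hm.ne', false_or] at hcoeff
    rw [Polynomial.coeff_natDegree, Polynomial.leadingCoeff_eq_zero] at hcoeff
    exact hne (by simp [hcoeff])
  have hq0 : q = 0 := by
    rw [Polynomial.eq_C_of_natDegree_eq_zero hdeg] at hq ⊢
    have := hq 0
    simp only [hW0, mul_zero, Finset.sum_const_zero, Polynomial.eval_C] at this
    rw [← this, Polynomial.C_0]
  have hp0 : p = 0 := by simpa [hq0] using hode.symm
  funext i
  have := hpc i
  simpa [hp0, Fin.val_inj] using this.symm

theorem exists_polynomial_of_growth {P : ℂ → ℂ} (hP : Differentiable ℂ P) (N : ℕ) {C T : ℝ}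
    (hC : ∀ w, T < ‖w‖ → ‖P w‖ ≤ C * ‖w‖ ^ N) :
    ∃ p : Polynomial ℂ, ∀ w, P w = p.eval w := by
  induction N generalizing P C T with
  | zero =>
    obtain ⟨B, hB⟩ := (isCompact_closedBall (0 : ℂ) T).exists_bound_of_continuousOn
      hP.continuous.continuousOn
    have hb : Bornology.IsBounded (range P) := by
      refine isBounded_iff_forall_norm_le.2 ⟨max B C, ?_⟩
      rintro _ ⟨w, rfl⟩
      rcases le_or_gt ‖w‖ T with h | h
      · exact (hB w (by simpa using h)).trans (le_max_left _ _)
      · exact (by simpa using hC w h : ‖P w‖ ≤ C).trans (le_max_right _ _)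
    obtain ⟨c, hc⟩ := hP.exists_eq_const_of_bounded hb
    exact ⟨Polynomial.C c, fun w => by simp [hc]⟩
  | succ N ih =>
    have hd : Differentiable ℂ (dslope P 0) := by
      rw [← differentiableOn_univ] at hP ⊢
      exact (Complex.differentiableOn_dslope univ_mem).2 hP
    obtain ⟨p, hp⟩ := ih hd (C := C + ‖P 0‖) (T := max T 1) (fun w hw => by
      have hw1 : 1 < ‖w‖ := (le_max_right _ _).trans_lt hw
      have hw0 : 0 < ‖w‖ := by linarith
      rw [dslope_of_ne P (norm_pos_iff.1 hw0), slope_def_module, norm_smul, norm_inv, sub_zero,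
        inv_mul_le_iff₀ hw0]
      have h1 := hC w ((le_max_left _ _).trans_lt hw)
      have h2 : ‖P 0‖ * 1 ≤ ‖P 0‖ * ‖w‖ ^ (N + 1) :=
        mul_le_mul_of_nonneg_left (one_le_pow₀ hw1.le) (norm_nonneg _)
      calc ‖P w - P 0‖ ≤ ‖P w‖ + ‖P 0‖ := norm_sub_le _ _
        _ ≤ C * ‖w‖ ^ (N + 1) + ‖P 0‖ * ‖w‖ ^ (N + 1) := by linarith
        _ = ‖w‖ * ((C + ‖P 0‖) * ‖w‖ ^ N) := by ring)
    refine ⟨Polynomial.C (P 0) + Polynomial.X * p, fun w => ?_⟩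
    have h := sub_smul_dslope P 0 w
    rw [hp, sub_zero, smul_eq_mul] at h
    simp [h]

end ModelEquation

section Germs

theorem isOpen_A'set : IsOpen A'set := isOpen_ne.preimage continuous_fst

/-- The filter of neighbourhoods of the origin in `A′`. -/
noncomputable def originFilter : Filter (ℂ × ℂ) := 𝓝[A'set] 0

theorem mem_originFilter_iff {s : Set (ℂ × ℂ)} :
    s ∈ originFilter ↔ ∃ r > 0, (ball (0 : ℂ) r \ {0}) ×ˢ ball (0 : ℂ) r ⊆ s := by
  have h : ∀ r, (ball (0 : ℂ) r \ {0}) ×ˢ ball (0 : ℂ) r = ball (0 : ℂ × ℂ) r ∩ A'set := fun r => by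
    ext ⟨a, b⟩
    have hb : (a, b) ∈ ball (0 : ℂ × ℂ) r ↔ a ∈ ball (0 : ℂ) r ∧ b ∈ ball (0 : ℂ) r := by
      simp only [mem_ball_zero_iff, Prod.norm_def, max_lt_iff]
    simp only [mem_inter_iff, hb, mem_prod, Set.mem_sdiff, mem_singleton_iff]
    exact ⟨fun h => ⟨⟨h.1.1, h.2⟩, h.1.2⟩, fun h => ⟨⟨h.1.1, h.2⟩, h.1.2⟩⟩
  simp only [h]
  exact (nhdsWithin_hasBasis nhds_basis_ball A'set).mem_iff

theorem eventually_originFilter_fst_ne_zero : ∀ᶠ z in originFilter, z.1 ≠ 0 :=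
  self_mem_nhdsWithin

theorem Filter.Eventually.of_nhds_origin {p : ℂ × ℂ → Prop} (h : ∀ᶠ z in 𝓝 0, p z) :
    ∀ᶠ z in originFilter, p z :=
  nhdsWithin_le_nhds h

theorem Filter.Eventually.eventually_nhds_originFilter {p : ℂ × ℂ → Prop}
    (h : ∀ᶠ z in originFilter, p z) : ∀ᶠ z in originFilter, ∀ᶠ y in 𝓝 z, p y := by
  have h' : ∀ᶠ z in originFilter, ∀ᶠ y in 𝓝[A'set] z, p y := eventually_eventually_nhdsWithin.2 h
  filter_upwards [h', eventually_originFilter_fst_ne_zero] with z hz hz0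
  rwa [isOpen_A'set.nhdsWithin_eq hz0] at hz

variable {f g : ℂ × ℂ → ℂ}

theorem mem_E'sp_iff : f ∈ E'sp ↔ ∀ᶠ z in originFilter, DifferentiableAt ℂ f z := by
  constructor
  · rintro ⟨V, hV, h0, hf⟩
    have hVA : IsOpen (V ∩ A'set) := hV.inter isOpen_A'set
    filter_upwards [mem_nhdsWithin_of_mem_nhds (hV.mem_nhds h0), self_mem_nhdsWithin] with z h1 h2
    exact hf.differentiableAt (hVA.mem_nhds ⟨h1, h2⟩)
  · intro h
    obtain ⟨V, hV, h0, hs⟩ := mem_nhdsWithin.1 h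
    exact ⟨V, hV, h0, fun z hz => (hs hz).differentiableWithinAt⟩

theorem mem_Mset_iff : f ∈ Mset ↔ ∃ (N : ℕ) (g : ℂ × ℂ → ℂ),
    (∀ᶠ z in 𝓝 0, DifferentiableAt ℂ g z) ∧
      ∀ᶠ z in originFilter, f z = (z.1 ^ N)⁻¹ * g z := by
  constructor
  · rintro ⟨V, hV, h0, N, g, hg, hfg⟩
    have hV0 : V ∈ 𝓝 (0 : ℂ × ℂ) := hV.mem_nhds h0
    refine ⟨N, g, ?_, ?_⟩
    · filter_upwards [hV0] with z hz using hg.differentiableAt (hV.mem_nhds hz)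
    · filter_upwards [mem_nhdsWithin_of_mem_nhds hV0, self_mem_nhdsWithin] with z h1 h2
      rw [hfg z ⟨h1, h2⟩, inv_mul_cancel_left₀ (pow_ne_zero N h2)]
  · rintro ⟨N, g, hg, hfg⟩
    obtain ⟨V₁, hs₁, hV₁, h0₁⟩ := _root_.mem_nhds_iff.1 hg
    obtain ⟨V₂, hV₂, h0₂, hs₂⟩ := mem_nhdsWithin.1 hfg
    refine ⟨V₁ ∩ V₂, hV₁.inter hV₂, ⟨h0₁, h0₂⟩, N, g,
      fun z hz => (hs₁ hz.1).differentiableWithinAt, fun z hz => ?_⟩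
    have h : f z = (z.1 ^ N)⁻¹ * g z := hs₂ ⟨hz.1.2, hz.2⟩
    rw [h, mul_inv_cancel_left₀ (pow_ne_zero N hz.2)]

theorem Mset_congr (hf : f ∈ Mset) (h : f =ᶠ[originFilter] g) : g ∈ Mset := by
  obtain ⟨N, k, hk, hfk⟩ := mem_Mset_iff.1 hf
  refine mem_Mset_iff.2 ⟨N, k, hk, ?_⟩
  filter_upwards [h, hfk] with z h1 h2
  rw [← h1, h2]

theorem mem_Mset_of_differentiableAt (hf : ∀ᶠ z in 𝓝 0, DifferentiableAt ℂ f z) : f ∈ Mset :=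
  mem_Mset_iff.2 ⟨0, f, hf, Eventually.of_forall fun z => by simp⟩

/-- Representatives of germs in `𝔐` as a submodule. -/
def meroSubmodule : Submodule ℂ (ℂ × ℂ → ℂ) where
  carrier := Mset
  zero_mem' := mem_Mset_of_differentiableAt (Eventually.of_forall fun z => differentiableAt_const _)
  add_mem' := by
    intro f g hf hg
    obtain ⟨N, k, hk, hfk⟩ := mem_Mset_iff.1 hf
    obtain ⟨N', k', hk', hgk⟩ := mem_Mset_iff.1 hg
    refine mem_Mset_iff.2 ⟨N + N', fun z => z.1 ^ N' * k z + z.1 ^ N * k' z, ?_, ?_⟩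
    · filter_upwards [hk, hk'] with z h1 h2
      fun_prop
    · filter_upwards [hfk, hgk, eventually_originFilter_fst_ne_zero] with z h1 h2 h3
      rw [Pi.add_apply, h1, h2]
      field_simp
      ring
  smul_mem' := by
    intro c f hf
    obtain ⟨N, k, hk, hfk⟩ := mem_Mset_iff.1 hf
    refine mem_Mset_iff.2 ⟨N, fun z => c * k z, ?_, ?_⟩
    · filter_upwards [hk] with z h1
      fun_prop
    · filter_upwards [hfk] with z h1
      rw [Pi.smul_apply, h1, smul_eq_mul]
      ring

theorem Mset_zpow_mul (hf : f ∈ Mset) (k : ℤ) : (fun z => z.1 ^ k * f z) ∈ Mset := by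
  obtain ⟨N, g, hg, hfg⟩ := mem_Mset_iff.1 hf
  rcases Int.eq_nat_or_neg k with ⟨n, rfl | rfl⟩
  · refine mem_Mset_iff.2 ⟨N, fun z => z.1 ^ n * g z, ?_, ?_⟩
    · filter_upwards [hg] with z h1
      fun_prop
    · filter_upwards [hfg] with z h1
      rw [h1, zpow_natCast]
      ring
  · refine mem_Mset_iff.2 ⟨N + n, g, hg, ?_⟩
    filter_upwards [hfg] with z h1
    rw [h1, zpow_neg, zpow_natCast, pow_add, mul_inv]
    ring

theorem Mset_subset_E'sp : Mset ⊆ E'sp := by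
  intro f hf
  obtain ⟨N, g, hg, hfg⟩ := mem_Mset_iff.1 hf
  refine mem_E'sp_iff.2 ?_
  filter_upwards [hfg.eventually_nhds_originFilter, hg.of_nhds_origin,
    eventually_originFilter_fst_ne_zero] with z h1 h2 h3
  refine DifferentiableAt.congr_of_eventuallyEq (f := fun z => (z.1 ^ N)⁻¹ * g z) ?_ h1
  have h4 : DifferentiableAt ℂ (fun z : ℂ × ℂ => (z.1 ^ N)⁻¹) z :=
    DifferentiableAt.inv (by fun_prop) (pow_ne_zero N h3)
  exact h4.mul h2

theorem differentiableAt_pd1 {x : ℂ × ℂ} (h : ∀ᶠ z in 𝓝 x, DifferentiableAt ℂ f z) :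
    DifferentiableAt ℂ (pd1 f) x := by
  obtain ⟨V, hs, hV, hx⟩ := _root_.mem_nhds_iff.1 h
  exact (differentiableOn_pd1 hV fun z hz => (hs hz).differentiableWithinAt).differentiableAt
    (hV.mem_nhds hx)

theorem differentiableAt_pd2 {x : ℂ × ℂ} (h : ∀ᶠ z in 𝓝 x, DifferentiableAt ℂ f z) :
    DifferentiableAt ℂ (pd2 f) x := by
  obtain ⟨V, hs, hV, hx⟩ := _root_.mem_nhds_iff.1 h
  exact (differentiableOn_pd2 hV fun z hz => (hs hz).differentiableWithinAt).differentiableAt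
    (hV.mem_nhds hx)

theorem Mset_pd1 (hf : f ∈ Mset) : pd1 f ∈ Mset := by
  obtain ⟨N, g, hg, hfg⟩ := mem_Mset_iff.1 hf
  refine mem_Mset_iff.2 ⟨N + 1, fun z => z.1 * pd1 g z - N * g z, ?_, ?_⟩
  · filter_upwards [hg.eventually_nhds] with z hz
    have h1 := differentiableAt_pd1 hz
    have h2 := hz.self_of_nhds
    fun_prop
  · filter_upwards [hfg.eventually_nhds_originFilter, hg.of_nhds_origin,
      eventually_originFilter_fst_ne_zero] with z h1 h2 h3
    rw [EventuallyEq.pd1_eq h1]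
    refine HasDerivAt.deriv (HasDerivAt.congr_deriv
      (((hasDerivAt_pow N z.1).fun_inv (pow_ne_zero N h3)).fun_mul h2.hasDerivAt_pd1) ?_)
    rcases N with _ | n
    · simp [h3]
    · field_simp
      simp only [Nat.add_sub_cancel]
      ring

theorem Mset_pd2 (hf : f ∈ Mset) : pd2 f ∈ Mset := by
  obtain ⟨N, g, hg, hfg⟩ := mem_Mset_iff.1 hf
  refine mem_Mset_iff.2 ⟨N, pd2 g, ?_, ?_⟩
  · filter_upwards [hg.eventually_nhds] with z hz using differentiableAt_pd2 hz
  · filter_upwards [hfg.eventually_nhds_originFilter, hg.of_nhds_origin] with z h1 h2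
    rw [EventuallyEq.pd2_eq h1]
    exact (h2.hasDerivAt_pd2.const_mul (z.1 ^ N)⁻¹).deriv

theorem E'sp_add (hf : f ∈ E'sp) (hg : g ∈ E'sp) : f + g ∈ E'sp := by
  rw [mem_E'sp_iff] at *
  filter_upwards [hf, hg] with z h1 h2 using h1.add h2

theorem E'sp_sub (hf : f ∈ E'sp) (hg : g ∈ E'sp) : f - g ∈ E'sp := by
  rw [mem_E'sp_iff] at *
  filter_upwards [hf, hg] with z h1 h2 using h1.sub h2

theorem E'sp_smul (c : ℂ) (hf : f ∈ E'sp) : c • f ∈ E'sp := by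
  rw [mem_E'sp_iff] at *
  filter_upwards [hf] with z h1 using h1.const_smul c

theorem differentiableAt_model_factor (m : ℕ) {x : ℂ × ℂ} (hx : x.1 ≠ 0) :
    DifferentiableAt ℂ (fun z : ℂ × ℂ => (m : ℂ) * z.1 ^ (-(m : ℤ) - 1)) x :=
  (DifferentiableAt.zpow differentiableAt_fst (Or.inl hx)).const_mul _

theorem E'sp_φ1 (m : ℕ) (hf : f ∈ E'sp) : φ1 m f ∈ E'sp := by
  rw [mem_E'sp_iff] at *
  filter_upwards [hf.eventually_nhds_originFilter, eventually_originFilter_fst_ne_zero] with z h1 h2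
  exact (differentiableAt_pd1 h1).sub ((differentiableAt_model_factor m h2).mul h1.self_of_nhds)

theorem φ1_congr (m : ℕ) (h : f =ᶠ[originFilter] g) : φ1 m f =ᶠ[originFilter] φ1 m g := by
  filter_upwards [h.eventually_nhds_originFilter] with z hz
  have hz' : f =ᶠ[𝓝 z] g := hz
  simp only [φ1, hz'.pd1_eq, hz'.eq_of_nhds]

theorem φ1_add (m : ℕ) (hf : f ∈ E'sp) (hg : g ∈ E'sp) :
    φ1 m (f + g) =ᶠ[originFilter] φ1 m f + φ1 m g := by
  filter_upwards [mem_E'sp_iff.1 hf, mem_E'sp_iff.1 hg] with z h1 h2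
  have h : pd1 (f + g) z = pd1 f z + pd1 g z := (h1.hasDerivAt_pd1.add h2.hasDerivAt_pd1).deriv
  simp only [φ1, h, Pi.add_apply]
  ring

theorem φ1_smul (m : ℕ) (c : ℂ) (hf : f ∈ E'sp) :
    φ1 m (c • f) =ᶠ[originFilter] c • φ1 m f := by
  filter_upwards [mem_E'sp_iff.1 hf] with z h1
  have h : pd1 (c • f) z = c * pd1 f z := (h1.hasDerivAt_pd1.const_mul c).deriv
  simp only [φ1, h, Pi.smul_apply, smul_eq_mul]
  ring

theorem φ2_add (hf : f ∈ E'sp) (hg : g ∈ E'sp) :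
    φ2 (f + g) =ᶠ[originFilter] φ2 f + φ2 g := by
  filter_upwards [mem_E'sp_iff.1 hf, mem_E'sp_iff.1 hg] with z h1 h2
  exact (h1.hasDerivAt_pd2.add h2.hasDerivAt_pd2).deriv

theorem φ2_sub (hf : f ∈ E'sp) (hg : g ∈ E'sp) :
    φ2 (f - g) =ᶠ[originFilter] φ2 f - φ2 g := by
  filter_upwards [mem_E'sp_iff.1 hf, mem_E'sp_iff.1 hg] with z h1 h2
  exact (h1.hasDerivAt_pd2.sub h2.hasDerivAt_pd2).deriv

theorem φ2_smul (c : ℂ) (hf : f ∈ E'sp) : φ2 (c • f) =ᶠ[originFilter] c • φ2 f := by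
  filter_upwards [mem_E'sp_iff.1 hf] with z h1
  exact (h1.hasDerivAt_pd2.const_mul c).deriv

theorem Mset_φ1 (m : ℕ) (hf : f ∈ Mset) : φ1 m f ∈ Mset := by
  have h := meroSubmodule.sub_mem (Mset_pd1 hf)
    (meroSubmodule.smul_mem (m : ℂ) (Mset_zpow_mul hf (-(m : ℤ) - 1)))
  have e : φ1 m f = pd1 f - (m : ℂ) • fun z => z.1 ^ (-(m : ℤ) - 1) * f z := by
    funext z
    simp only [φ1, Pi.sub_apply, Pi.smul_apply, smul_eq_mul, mul_assoc]
  rw [e]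
  exact h

theorem φ2_φ1_comm (m : ℕ) (hf : f ∈ E'sp) :
    φ2 (φ1 m f) =ᶠ[originFilter] φ1 m (φ2 f) := by
  filter_upwards [(mem_E'sp_iff.1 hf).eventually_nhds_originFilter] with z h1
  obtain ⟨V, hs, hV, hz⟩ := _root_.mem_nhds_iff.1 h1
  have hcomm := pd1_pd2_comm hV (fun z hz => (hs hz).differentiableWithinAt) hz
  have hd := (differentiableAt_pd1 h1).hasDerivAt_pd2.sub
    (h1.self_of_nhds.hasDerivAt_pd2.const_mul ((m : ℂ) * z.1 ^ (-(m : ℤ) - 1)))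
  rw [← hcomm] at hd
  exact hd.deriv

theorem ψop_φ_eventuallyEq_zero (m : ℕ) (hf : f ∈ E'sp) :
    (0 : ℂ × ℂ → ℂ) =ᶠ[originFilter] ψop m (φ1 m f) (φ2 f) := by
  filter_upwards [φ2_φ1_comm m hf] with z hz
  exact (sub_eq_zero.2 hz.symm).symm

theorem exists_E'sp_primitive (hf : f ∈ E'sp) : ∃ F ∈ E'sp, pd2 F =ᶠ[originFilter] f := by
  obtain ⟨r, hr, hs⟩ := mem_originFilter_iff.1 (mem_E'sp_iff.1 hf)
  have hS : IsOpen (ball (0 : ℂ) r \ {0}) := isOpen_ball.sdiff isClosed_singleton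
  obtain ⟨F, hF, hFf⟩ := exists_pd2_primitive hS fun z hz => (hs hz).differentiableWithinAt
  refine ⟨F, mem_E'sp_iff.2 (mem_originFilter_iff.2 ⟨r, hr, fun z hz => ?_⟩),
    mem_originFilter_iff.2 ⟨r, hr, hFf⟩⟩
  exact hF.differentiableAt ((hS.prod isOpen_ball).mem_nhds hz)

theorem exists_Mset_primitive (hf : f ∈ Mset) : ∃ F ∈ Mset, pd2 F =ᶠ[originFilter] f := by
  obtain ⟨N, g, hg, hfg⟩ := mem_Mset_iff.1 hf
  obtain ⟨r, hr, hs⟩ := nhds_basis_ball.mem_iff.1 hg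
  have hball : ball (0 : ℂ × ℂ) r = ball (0 : ℂ) r ×ˢ ball (0 : ℂ) r := (ball_prod_same _ _ _).symm
  obtain ⟨G, hG, hGg⟩ := exists_pd2_primitive (f := g) (r := r) (isOpen_ball (x := (0 : ℂ)) (ε := r))
    fun z hz => (hs (hball ▸ hz)).differentiableWithinAt
  rw [← hball] at hG hGg
  have hGd : ∀ᶠ z in 𝓝 0, DifferentiableAt ℂ G z := by
    filter_upwards [ball_mem_nhds 0 hr] with z hz using
      hG.differentiableAt (isOpen_ball.mem_nhds hz)
  have hGe : ∀ᶠ z in 𝓝 0, pd2 G z = g z := by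
    filter_upwards [ball_mem_nhds 0 hr] with z hz using hGg z hz
  refine ⟨fun z => (z.1 ^ N)⁻¹ * G z, mem_Mset_iff.2 ⟨N, G, hGd, Eventually.of_forall fun _ => rfl⟩,
    ?_⟩
  filter_upwards [hfg, hGd.of_nhds_origin, hGe.of_nhds_origin] with z h1 h2 h3
  rw [h1, ← h3]
  exact (h2.hasDerivAt_pd2.const_mul (z.1 ^ N)⁻¹).deriv

theorem exists_entire_of_pd2_mem_Mset (hf : f ∈ E'sp) (h2 : pd2 f ∈ Mset) :
    ∃ U : ℂ → ℂ, Differentiable ℂ U ∧ (f - fun z => U z.1⁻¹) ∈ Mset := by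
  obtain ⟨F, hF, hFf⟩ := exists_Mset_primitive h2
  have hu : f - F ∈ E'sp := E'sp_sub hf (Mset_subset_E'sp hF)
  have hu2 : ∀ᶠ z in originFilter, pd2 (f - F) z = 0 := by
    filter_upwards [φ2_sub hf (Mset_subset_E'sp hF), hFf] with z h1 h3
    rw [show pd2 (f - F) z = pd2 f z - pd2 F z from h1, h3, sub_self]
  obtain ⟨r, hr, hs⟩ := mem_originFilter_iff.1 ((mem_E'sp_iff.1 hu).and hu2)
  have hconst : ∀ z ∈ (ball (0 : ℂ) r \ {0}) ×ˢ ball (0 : ℂ) r, (f - F) z = (f - F) (z.1, 0) := by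
    rintro ⟨a, b⟩ ⟨ha, hb⟩
    have hd : ∀ w ∈ ball (0 : ℂ) r, HasDerivAt (fun w => (f - F) (a, w)) 0 w := fun w hw => by
      have h := hs (mk_mem_prod ha hw)
      have hw' := h.1.hasDerivAt_pd2
      rwa [h.2] at hw'
    exact isOpen_ball.is_const_of_deriv_eq_zero (convex_ball (0 : ℂ) r).isPreconnected
      (fun w hw => (hd w hw).differentiableAt.differentiableWithinAt)
      (fun w hw => (hd w hw).deriv) hb (mem_ball_self hr)
  have hslice : DifferentiableOn ℂ (fun w => (f - F) (w, 0)) (ball 0 r \ {0}) := fun w hw =>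
    (hs (mk_mem_prod hw (mem_ball_self hr))).1.hasDerivAt_pd1.differentiableAt.differentiableWithinAt
  obtain ⟨U, h, δ, hU, hδ, hδr, hh, hsplit⟩ :=
    exists_entire_add_of_differentiableOn_punctured hr hslice
  refine ⟨U, hU, ?_⟩
  have hhM : (fun z : ℂ × ℂ => h z.1) ∈ Mset := by
    refine mem_Mset_of_differentiableAt ?_
    have hc : ∀ᶠ z : ℂ × ℂ in 𝓝 0, z.1 ∈ ball (0 : ℂ) δ :=
      continuous_fst.continuousAt.eventually (ball_mem_nhds _ hδ)
    filter_upwards [hc] with z hz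
    exact (hh.differentiableAt (isOpen_ball.mem_nhds hz)).comp z differentiableAt_fst
  refine Mset_congr (meroSubmodule.add_mem hF hhM) (mem_originFilter_iff.2 ⟨δ, hδ, fun z hz => ?_⟩)
  have e1 := hconst z ⟨⟨ball_subset_ball hδr hz.1.1, hz.1.2⟩, ball_subset_ball hδr hz.2⟩
  have e2 := hsplit z.1 hz.1
  rw [e2] at e1
  simp only [Pi.sub_apply] at e1
  simp only [mem_ofPred_eq, Pi.add_apply, Pi.sub_apply]
  linear_combination -e1

end Germs

section Cohomology

/-- Pullback of functions of one variable along `z ↦ z₁⁻¹`. -/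
noncomputable def invPullback : (ℂ → ℂ) →ₗ[ℂ] ℂ × ℂ → ℂ := LinearMap.funLeft ℂ ℂ fun z => z.1⁻¹

theorem invPullback_apply (U : ℂ → ℂ) (z : ℂ × ℂ) : invPullback U z = U z.1⁻¹ := rfl

variable {m : ℕ} {U R : ℂ → ℂ}

theorem invPullback_mem_E'sp (hU : Differentiable ℂ U) : invPullback U ∈ E'sp := by
  refine mem_E'sp_iff.2 ?_
  filter_upwards [eventually_originFilter_fst_ne_zero] with z hz
  have h : DifferentiableAt ℂ (fun z : ℂ × ℂ => z.1⁻¹) z := differentiableAt_fst.inv hz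
  exact DifferentiableAt.comp (g := U) z (hU z.1⁻¹) h

theorem φ2_invPullback (U : ℂ → ℂ) : φ2 (invPullback U) = 0 :=
  funext fun z => deriv_const z.2 (U z.1⁻¹)

theorem IsModelSolution.φ1_invPullback (hm : 0 < m) (hU : IsModelSolution m R U) :
    φ1 m (invPullback U) =ᶠ[originFilter] fun z => -(z.1 ^ (-2 : ℤ) * R z.1⁻¹) := by
  filter_upwards [eventually_originFilter_fst_ne_zero] with z hz
  have h : pd1 (invPullback U) z =
      (R z.1⁻¹ - m * z.1⁻¹ ^ (m - 1) * U z.1⁻¹) * -(z.1 ^ 2)⁻¹ :=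
    ((hU z.1⁻¹).comp z.1 (hasDerivAt_inv hz)).deriv
  obtain ⟨n, rfl⟩ := Nat.exists_eq_add_of_le' hm
  have e : z.1 ^ (-((n + 1 : ℕ) : ℤ) - 1) = z.1⁻¹ ^ n * (z.1 ^ 2)⁻¹ := by
    rw [show -((n + 1 : ℕ) : ℤ) - 1 = -((n + 2 : ℕ) : ℤ) by push_cast; ring, zpow_neg,
      zpow_natCast, pow_add, mul_inv, inv_pow]
  have e2 : z.1 ^ (-2 : ℤ) = (z.1 ^ 2)⁻¹ := by
    rw [zpow_neg]
    norm_cast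
  simp only [φ1, h, e, e2, invPullback_apply, Nat.add_sub_cancel]
  ring

theorem invPullback_eval_mem_Mset (p : Polynomial ℂ) : invPullback (fun w => p.eval w) ∈ Mset := by
  have h1 : (fun _ => 1 : ℂ × ℂ → ℂ) ∈ Mset :=
    mem_Mset_of_differentiableAt (Eventually.of_forall fun z => differentiableAt_const _)
  have h := meroSubmodule.sum_mem (t := Finset.range (p.natDegree + 1)) fun n _ =>
    meroSubmodule.smul_mem (p.coeff n) (Mset_zpow_mul h1 (-(n : ℤ)))
  refine Mset_congr h (Eventually.of_forall fun z => ?_)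
  simp [invPullback_apply, Polynomial.eval_eq_sum_range]

theorem exists_polynomial_of_invPullback_mem_Mset (hU : Differentiable ℂ U)
    (h : invPullback U ∈ Mset) : ∃ p : Polynomial ℂ, ∀ w, U w = p.eval w := by
  obtain ⟨N, g, hg, hUg⟩ := mem_Mset_iff.1 h
  have hb : ∀ᶠ z in 𝓝 (0 : ℂ × ℂ), ‖g z‖ < ‖g 0‖ + 1 :=
    hg.self_of_nhds.continuousAt.norm.eventually_lt continuousAt_const (lt_add_one _)
  obtain ⟨r, hr, hs⟩ := mem_originFilter_iff.1 (hUg.and hb.of_nhds_origin)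
  refine exists_polynomial_of_growth hU N (C := ‖g 0‖ + 1) (T := r⁻¹) fun w hw => ?_
  have hw0 : 0 < ‖w‖ := (inv_pos.2 hr).trans hw
  have hmem : ((w⁻¹, 0) : ℂ × ℂ) ∈ (ball (0 : ℂ) r \ {0}) ×ˢ ball (0 : ℂ) r := by
    refine ⟨⟨?_, inv_ne_zero (norm_pos_iff.1 hw0)⟩, mem_ball_self hr⟩
    rw [mem_ball_zero_iff, norm_inv]
    exact inv_lt_of_inv_lt₀ hr hw
  obtain ⟨h1, h2⟩ := hs hmem
  simp only [invPullback_apply, inv_inv, inv_pow] at h1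
  rw [h1, norm_mul, norm_pow, mul_comm]
  gcongr

/-- Representatives of the kernel of `φ̄`. -/
def kerSubmodule (m : ℕ) : Submodule ℂ (ℂ × ℂ → ℂ) where
  carrier := {u | u ∈ E'sp ∧ φ1 m u ∈ Mset ∧ φ2 u ∈ Mset}
  zero_mem' := by
    have h0 : (0 : ℂ × ℂ → ℂ) ∈ Mset := meroSubmodule.zero_mem
    exact ⟨Mset_subset_E'sp h0, Mset_φ1 m h0, Mset_pd2 h0⟩
  add_mem' := fun hf hg => ⟨E'sp_add hf.1 hg.1,
    Mset_congr (meroSubmodule.add_mem hf.2.1 hg.2.1) (φ1_add m hf.1 hg.1).symm,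
    Mset_congr (meroSubmodule.add_mem hf.2.2 hg.2.2) (φ2_add hf.1 hg.1).symm⟩
  smul_mem' := fun c _ hf => ⟨E'sp_smul c hf.1,
    Mset_congr (meroSubmodule.smul_mem c hf.2.1) (φ1_smul m c hf.1).symm,
    Mset_congr (meroSubmodule.smul_mem c hf.2.2) (φ2_smul c hf.1).symm⟩

theorem meroSubmodule_le_kerSubmodule (m : ℕ) : meroSubmodule ≤ kerSubmodule m := fun _ hf =>
  ⟨Mset_subset_E'sp hf, Mset_φ1 m hf, Mset_pd2 hf⟩

theorem IsModelSolution.invPullback_mem_kerSubmodule (hm : 0 < m) {p : Polynomial ℂ}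
    (hU : IsModelSolution m (fun w => p.eval w) U) : invPullback U ∈ kerSubmodule m := by
  refine ⟨invPullback_mem_E'sp hU.differentiable, ?_, ?_⟩
  · exact Mset_congr (meroSubmodule.neg_mem (Mset_zpow_mul (invPullback_eval_mem_Mset p) (-2)))
      (hU.φ1_invPullback hm).symm
  · rw [φ2_invPullback]
    exact meroSubmodule.zero_mem

theorem exists_isModelSolution_sub_mem_Mset (hm : 0 < m) {u : ℂ × ℂ → ℂ}
    (hu : u ∈ kerSubmodule m) : ∃ (U : ℂ → ℂ) (p : Polynomial ℂ),
      IsModelSolution m (fun w => p.eval w) U ∧ u - invPullback U ∈ Mset := by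
  obtain ⟨U, hU, hM⟩ := exists_entire_of_pd2_mem_Mset hu.1 hu.2.2
  have hM' : u - invPullback U ∈ Mset := hM
  have hUK : φ1 m (invPullback U) ∈ Mset := by
    have h := (kerSubmodule m).sub_mem hu (meroSubmodule_le_kerSubmodule m hM')
    rw [sub_sub_cancel] at h
    exact h.2.1
  have hd : Differentiable ℂ (deriv U) := hU.deriv
  have hR : Differentiable ℂ fun w => deriv U w + m * w ^ (m - 1) * U w := by fun_prop
  have hsol : IsModelSolution m (fun w => deriv U w + m * w ^ (m - 1) * U w) U := fun w =>
    (hU w).hasDerivAt.congr_deriv (by ring)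
  have hRM : invPullback (fun w => deriv U w + m * w ^ (m - 1) * U w) ∈ Mset := by
    refine Mset_congr (meroSubmodule.neg_mem (Mset_zpow_mul hUK 2)) ?_
    filter_upwards [hsol.φ1_invPullback hm, eventually_originFilter_fst_ne_zero] with z h1 h2
    rw [Pi.neg_apply, h1, mul_neg, neg_neg, ← mul_assoc, ← zpow_add₀ h2]
    simp [invPullback_apply]
  obtain ⟨p, hp⟩ := exists_polynomial_of_invPullback_mem_Mset hR hRM
  exact ⟨U, p, by simpa only [hp] using hsol, hM'⟩

theorem finrank_kerSubmodule_quotient (hm : 0 < m) :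
    Module.finrank ℂ (kerSubmodule m ⧸ meroSubmodule.comap (kerSubmodule m).subtype) = m := by
  choose W hW hW0 using fun k : ℕ =>
    exists_isModelSolution m (R := fun w : ℂ => w ^ k) (differentiable_pow k)
  have hWK : ∀ k, invPullback (W k) ∈ kerSubmodule m := fun k =>
    IsModelSolution.invPullback_mem_kerSubmodule hm (p := Polynomial.X ^ k) (by simpa using hW k)
  let S : (Fin m → ℂ) →ₗ[ℂ] kerSubmodule m :=
    Fintype.linearCombination ℂ fun i : Fin m => ⟨invPullback (W i), hWK i⟩
  have hS : ∀ c, (S c : ℂ × ℂ → ℂ) = invPullback fun w => ∑ i, c i * W i w := fun c => by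
    funext z
    simp [S, Fintype.linearCombination_apply, invPullback_apply]
  let T := (meroSubmodule.comap (kerSubmodule m).subtype).mkQ ∘ₗ S
  have hinj : Function.Injective T := by
    refine (injective_iff_map_eq_zero T).2 fun c hc => ?_
    have hM : (S c : ℂ × ℂ → ℂ) ∈ Mset := (Submodule.Quotient.mk_eq_zero _).1 hc
    rw [hS] at hM
    have hd : Differentiable ℂ fun w => ∑ i, c i * W i w :=
      Differentiable.fun_sum fun i _ => (hW i).differentiable.const_mul (c i)
    obtain ⟨q, hq⟩ := exists_polynomial_of_invPullback_mem_Mset hd hM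
    exact eq_zero_of_sum_eq_eval hW hW0 hq
  have hsurj : Function.Surjective T := by
    intro x
    obtain ⟨u, rfl⟩ := Submodule.mkQ_surjective _ x
    obtain ⟨U, p, hU, hM⟩ := exists_isModelSolution_sub_mem_Mset hm u.2
    obtain ⟨c, q, hcq⟩ := mem_span_sup_range_eval hm hW hW0 hU
    refine ⟨c, Eq.symm ((Submodule.Quotient.eq _).2 ?_)⟩
    change (u : ℂ × ℂ → ℂ) - S c ∈ Mset
    have e : (u : ℂ × ℂ → ℂ) - S c =
        (u - invPullback U) + invPullback fun w => q.eval w := by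
      funext z
      simp only [hS, Pi.sub_apply, Pi.add_apply, invPullback_apply, hcq]
      ring
    rw [e]
    exact meroSubmodule.add_mem hM (invPullback_eval_mem_Mset q)
  rw [← (LinearEquiv.ofBijective T ⟨hinj, hsurj⟩).finrank_eq, Module.finrank_fin_fun]

theorem exists_φ1_invPullback_sub_mem_Mset (hm : 0 < m) {F : ℂ → ℂ} (hF : Differentiable ℂ F) :
    ∃ U, Differentiable ℂ U ∧ invPullback F - φ1 m (invPullback U) ∈ Mset := by
  have hds : ∀ {G : ℂ → ℂ}, Differentiable ℂ G → Differentiable ℂ (dslope G 0) := fun hG =>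
    differentiableOn_univ.1 ((Complex.differentiableOn_dslope univ_mem).2 hG.differentiableOn)
  obtain ⟨U, hU, -⟩ := exists_isModelSolution m (hds (hds hF)).neg
  refine ⟨U, hU.differentiable, ?_⟩
  refine Mset_congr (invPullback_eval_mem_Mset
    (Polynomial.C (F 0) + Polynomial.C (dslope F 0 0) * Polynomial.X)) ?_
  filter_upwards [hU.φ1_invPullback hm, eventually_originFilter_fst_ne_zero] with z h1 h2
  have e1 := sub_smul_dslope F 0 z.1⁻¹
  have e2 := sub_smul_dslope (dslope F 0) 0 z.1⁻¹
  have e3 : z.1 ^ (-2 : ℤ) = z.1⁻¹ * z.1⁻¹ := by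
    rw [zpow_neg, ← mul_inv]
    norm_cast
    rw [sq]
  rw [sub_zero, smul_eq_mul] at e1 e2
  simp only [Pi.sub_apply, h1, invPullback_apply, e3, Pi.neg_apply, Polynomial.eval_add,
    Polynomial.eval_mul, Polynomial.eval_C, Polynomial.eval_X]
  linear_combination e1 + z.1⁻¹ * e2

theorem exists_sub_φ_mem_Mset (hm : 0 < m) {ω₁ ω₂ : ℂ × ℂ → ℂ} (h₁ : ω₁ ∈ E'sp)
    (h₂ : ω₂ ∈ E'sp) (h : ψop m ω₁ ω₂ ∈ Mset) :
    ∃ u ∈ E'sp, ω₁ - φ1 m u ∈ Mset ∧ ω₂ - φ2 u ∈ Mset := by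
  obtain ⟨v, hv, hvω⟩ := exists_E'sp_primitive h₂
  have hφv := E'sp_φ1 m hv
  have hpd : pd2 (ω₁ - φ1 m v) ∈ Mset := by
    refine Mset_congr (meroSubmodule.neg_mem h) ?_
    filter_upwards [φ2_sub h₁ hφv, φ2_φ1_comm m hv, φ1_congr m hvω] with z e1 e2 e3
    have e4 : pd2 (ω₁ - φ1 m v) z = pd2 ω₁ z - φ2 (φ1 m v) z := e1
    have e5 : φ1 m (φ2 v) z = φ1 m ω₂ z := e3
    have e6 : ψop m ω₁ ω₂ z = φ1 m ω₂ z - pd2 ω₁ z := rfl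
    rw [e4, e2, e5, Pi.neg_apply, e6, neg_sub]
  obtain ⟨F, hF, hM⟩ := exists_entire_of_pd2_mem_Mset (E'sp_sub h₁ hφv) hpd
  obtain ⟨U, hU, hUM⟩ := exists_φ1_invPullback_sub_mem_Mset hm hF
  have hUE := invPullback_mem_E'sp hU
  refine ⟨v + invPullback U, E'sp_add hv hUE, ?_, ?_⟩
  · refine Mset_congr (meroSubmodule.add_mem hM hUM) ?_
    filter_upwards [φ1_add m hv hUE] with z e
    simp only [Pi.add_apply, Pi.sub_apply, e, invPullback_apply]
    ring
  · refine Mset_congr meroSubmodule.zero_mem ?_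
    filter_upwards [φ2_add hv hUE, hvω] with z e1 e2
    have e3 : φ2 v z = ω₂ z := e2
    rw [Pi.sub_apply, e1, φ2_invPullback, add_zero, e3, sub_self, Pi.zero_apply]

theorem exists_sub_ψop_mem_Mset (m : ℕ) {η : ℂ × ℂ → ℂ} (hη : η ∈ E'sp) :
    ∃ ω₁ ∈ E'sp, ∃ ω₂ ∈ E'sp, η - ψop m ω₁ ω₂ ∈ Mset := by
  have h0 : (0 : ℂ × ℂ → ℂ) ∈ E'sp := Mset_subset_E'sp meroSubmodule.zero_mem
  obtain ⟨v, hv, hvη⟩ := exists_E'sp_primitive hη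
  refine ⟨(-1 : ℂ) • v, E'sp_smul (-1) hv, 0, h0, Mset_congr meroSubmodule.zero_mem ?_⟩
  filter_upwards [φ2_smul (-1) hv, φ1_smul m 0 h0, hvη] with z e1 e2 e3
  have e4 : pd2 ((-1 : ℂ) • v) z = -1 * pd2 v z := e1
  have e5 : φ1 m 0 z = 0 := by simpa using e2
  have e6 : ψop m ((-1 : ℂ) • v) 0 z = φ1 m 0 z - pd2 ((-1 : ℂ) • v) z := rfl
  rw [Pi.sub_apply, e6, e4, e5, e3, Pi.zero_apply]
  ring

end Cohomology

/-- The propositions of Section 4.3 of the paper for the model connection `e^α`,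
`α = z₁^{−m}`, at a smooth point of the divisor `{z₁ = 0}`: the de Rham complex
induced by `φ`, `ψ` on `Q′ = 𝔈′/𝔐` has cohomology of dimension `m` in degree `0`
and vanishes in degrees `1` and `2`.  All statements about the induced maps are
expressed via representatives. -/
theorem local_deRham_dim_smooth_point (m : ℕ) (hm : 0 < m) :
    -- (i) φ and ψ preserve 𝔐, and ψ̄ ∘ φ̄ = 0
    (∀ f ∈ Mset, φ1 m f ∈ Mset ∧ φ2 f ∈ Mset) ∧
    (∀ f ∈ Mset, ∀ g ∈ Mset, ψop m f g ∈ Mset) ∧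
    (∀ u ∈ E'sp, ψop m (φ1 m u) (φ2 u) ∈ Mset) ∧
    -- (ii) dim ker φ̄ = m
    (∃ K L : Submodule ℂ (ℂ × ℂ → ℂ),
      (∀ u : ℂ × ℂ → ℂ, u ∈ K ↔
        u ∈ E'sp ∧ φ1 m u ∈ Mset ∧ φ2 u ∈ Mset) ∧
      (∀ u : ℂ × ℂ → ℂ, u ∈ L ↔ u ∈ Mset) ∧
      L ≤ K ∧
      Module.finrank ℂ (K ⧸ L.comap K.subtype) = m) ∧
    -- (iii) ker ψ̄ = im φ̄
    (∀ ω₁ ∈ E'sp, ∀ ω₂ ∈ E'sp, ψop m ω₁ ω₂ ∈ Mset →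
      ∃ u ∈ E'sp, ω₁ - φ1 m u ∈ Mset ∧ ω₂ - φ2 u ∈ Mset) ∧
    -- (iv) ψ̄ is surjective
    (∀ η ∈ E'sp, ∃ ω₁ ∈ E'sp, ∃ ω₂ ∈ E'sp, η - ψop m ω₁ ω₂ ∈ Mset) := by
  refine ⟨fun f hf => ⟨Mset_φ1 m hf, Mset_pd2 hf⟩,
    fun f hf g hg => meroSubmodule.sub_mem (Mset_φ1 m hg) (Mset_pd2 hf),
    fun u hu => Mset_congr meroSubmodule.zero_mem (ψop_φ_eventuallyEq_zero m hu),
    ⟨kerSubmodule m, meroSubmodule, fun u => Iff.rfl, fun u => Iff.rfl,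
      meroSubmodule_le_kerSubmodule m, finrank_kerSubmodule_quotient hm⟩,
    fun ω₁ h₁ ω₂ h₂ h => exists_sub_φ_mem_Mset hm h₁ h₂ h,
    fun η hη => exists_sub_ψop_mem_Mset m hη⟩
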